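/- There exists a universal constant c > 0 such that for all n ≥ 2, all ε with 1/n ≤ ε ≤ 1/2, and every subset A ⊆ L_mid with |A| = σ·2^n, there exists an integer ℓ with 0 ≤ ℓ ≤ m = ⌈log₂(n+1)⌉ such that Σ_{x ∈ A} Σ_{k ∈ B_ℓ} dens↓_k(x,A) ≥ c·ε⁸·σ²·√n·2^n / ((log₂ n)·√(ln(1/ε))). -/

import Mathlib

open Finset

/-- The Hamming weight `‖x‖₁` of `x ∈ {0,1}^n`. -/
def wt {n : ℕ} (x : Fin n → Bool) : ℕ :=
  (Finset.univ.filter (fun i => x i = true)).card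

/-- The Hamming distance `‖x − y‖₁`. -/
def hamm {n : ℕ} (x y : Fin n → Bool) : ℕ :=
  (Finset.univ.filter (fun i => x i ≠ y i)).card

/-- The parameter `d = d(n,ε) = 2⌈√(2n·ln(100/ε))⌉`. -/
noncomputable def dPar (n : ℕ) (ε : ℝ) : ℕ :=
  2 * ⌈Real.sqrt (2 * n * Real.log (100 / ε))⌉₊

open Classical in
/-- The middle layers `L_mid = {x : (n−d)/2 ≤ ‖x‖₁ ≤ (n+d)/2}`. -/
noncomputable def Lmid (n : ℕ) (ε : ℝ) : Finset (Fin n → Bool) :=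
  Finset.univ.filter (fun x =>
    ((n : ℝ) - dPar n ε) / 2 ≤ (wt x : ℝ) ∧ (wt x : ℝ) ≤ ((n : ℝ) + dPar n ε) / 2)

/-- The `j`-th point (from the bottom) of the path from `0^n` to `1^n` determined by the
permutation `π`: its ones are exactly in positions `π(0),…,π(j−1)`. -/
def pathPoint {n : ℕ} (π : Equiv.Perm (Fin n)) (j : ℕ) : Fin n → Bool :=
  fun i => decide ((π.symm i : ℕ) < j)

/-- The indices `j` of the points of the path `π` lying in the middle layers `L_mid`. -/
noncomputable def pmidIdx (n : ℕ) (ε : ℝ) (π : Equiv.Perm (Fin n)) : Finset ℕ :=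
  (Finset.range (n + 1)).filter (fun j => pathPoint π j ∈ Lmid n ε)

open Classical in
/-- `dens↓_k(x,A)`: the probability that a uniformly random `y ≼ x` with `‖x−y‖₁ = k`
lies in `A` (if `k ≤ ‖x‖₁`, and `0` otherwise). -/
noncomputable def densDown {n : ℕ} (x : Fin n → Bool) (A : Finset (Fin n → Bool)) (k : ℕ) : ℝ :=
  if k ≤ wt x then
    ((A.filter (fun y => (∀ i, y i ≤ x i) ∧ hamm y x = k)).card : ℝ) / ((wt x).choose k : ℝ)
  else 0

open Classical in
/-- `dens↑_k(x,A)`: the probability that a uniformly random `y ≽ x` with `‖y−x‖₁ = k`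
lies in `A` (if `k ≤ n − ‖x‖₁`, and `0` otherwise). -/
noncomputable def densUp {n : ℕ} (x : Fin n → Bool) (A : Finset (Fin n → Bool)) (k : ℕ) : ℝ :=
  if k ≤ n - wt x then
    ((A.filter (fun y => (∀ i, x i ≤ y i) ∧ hamm x y = k)).card : ℝ) / ((n - wt x).choose k : ℝ)
  else 0

/-- `score↓(x,A) = Σ_{k=0}^n dens↓_k(x,A)`. -/
noncomputable def scoreDown {n : ℕ} (x : Fin n → Bool) (A : Finset (Fin n → Bool)) : ℝ :=
  ∑ k ∈ Finset.range (n + 1), densDown x A k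

/-- `score↑(x,A) = Σ_{k=1}^n dens↑_k(x,A)`. -/
noncomputable def scoreUp {n : ℕ} (x : Fin n → Bool) (A : Finset (Fin n → Bool)) : ℝ :=
  ∑ k ∈ Finset.Icc 1 n, densUp x A k

/-- The buckets: `B₀ = {0}` and `B_i = {2^{i−1},…,2^i − 1}` for `i ≥ 1`. -/
def bucket (i : ℕ) : Finset ℕ := if i = 0 then {0} else Finset.Ico (2 ^ (i - 1)) (2 ^ i)

/-- `B′_i = {j + 1 : j ∈ B_i}`. -/
def bucket' (i : ℕ) : Finset ℕ := (bucket i).image (· + 1)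

/-- The number of buckets minus one: `m = ⌈log₂(n+1)⌉`. -/
def mPar (n : ℕ) : ℕ := Nat.clog 2 (n + 1)

namespace GB

lemma exists_perm_of_fibers {α β : Type*} [Fintype α] [DecidableEq β] (g g' : α → β)
    (h : ∀ b, (univ.filter (fun i => g i = b)).card = (univ.filter (fun i => g' i = b)).card) :
    ∃ τ : Equiv.Perm α, ∀ i, g' (τ i) = g i := by
  classical
  have e : ∀ b, Nonempty ({i // g i = b} ≃ {i // g' i = b}) := by
    intro b
    apply Fintype.card_eq.mp
    rw [Fintype.card_subtype, Fintype.card_subtype]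
    exact h b
  let e := fun b => (e b).some
  refine ⟨(Equiv.sigmaFiberEquiv g).symm.trans
    ((Equiv.sigmaCongrRight e).trans (Equiv.sigmaFiberEquiv g')), fun i => ?_⟩
  exact ((e (g i)) ⟨i, rfl⟩).2

lemma le_iff {n : ℕ} (x y : Fin n → Bool) :
    (∀ i, y i ≤ x i) ↔ ∀ i, y i = true → x i = true := by
  constructor
  · intro h i hi
    have := h i
    rw [hi] at this
    exact top_le_iff.mp this
  · intro h i
    cases hy : y i
    · simp
    · simp [h i hy]

lemma wt_le_of_le {n : ℕ} {x y : Fin n → Bool} (h : ∀ i, y i ≤ x i) : wt y ≤ wt x := by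
  rw [le_iff] at h
  apply card_le_card
  intro i hi
  simp only [mem_filter, mem_univ, true_and] at hi ⊢
  exact h i hi

lemma hamm_add {n : ℕ} {x y : Fin n → Bool} (h : ∀ i, y i ≤ x i) : hamm y x + wt y = wt x := by
  rw [le_iff] at h
  unfold hamm wt
  rw [← card_union_of_disjoint]
  · congr 1
    ext i
    simp only [mem_union, mem_filter, mem_univ, true_and]
    have := h i
    cases hy : y i <;> cases hx : x i <;> simp_all
  · rw [Finset.disjoint_left]
    intro i
    simp only [mem_filter, mem_univ, true_and]
    have := h i
    cases hy : y i <;> cases hx : x i <;> simp_all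

lemma wt_le {n : ℕ} (x : Fin n → Bool) : wt x ≤ n := by
  unfold wt
  simpa using card_le_univ (univ.filter (fun i => x i = true))

lemma exists_perm {n : ℕ} {x y y' : Fin n → Bool} (h : ∀ i, y i ≤ x i) (h' : ∀ i, y' i ≤ x i)
    (hw : wt y = wt y') :
    ∃ τ : Equiv.Perm (Fin n), (∀ i, x (τ i) = x i) ∧ ∀ i, y' (τ i) = y i := by
  have hh := hamm_add h
  have hh' := hamm_add h'
  rw [le_iff] at h h'
  have key := exists_perm_of_fibers (fun i => (x i, y i)) (fun i => (x i, y' i)) ?_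
  · obtain ⟨τ, hτ⟩ := key
    refine ⟨τ, fun i => (Prod.ext_iff.mp (hτ i)).1, fun i => (Prod.ext_iff.mp (hτ i)).2⟩
  · rintro ⟨a, b⟩
    simp only [Prod.mk.injEq]
    have e1 : ∀ z : Fin n → Bool, (∀ i, z i = true → x i = true) →
        univ.filter (fun i => x i = true ∧ z i = true) = univ.filter (fun i => z i = true) := by
      intro z hz; ext i; simp only [mem_filter, mem_univ, true_and]
      exact ⟨fun h => h.2, fun h => ⟨hz i h, h⟩⟩
    have e2 : ∀ z : Fin n → Bool, (∀ i, z i = true → x i = true) →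
        univ.filter (fun i => x i = true ∧ z i = false) = univ.filter (fun i => z i ≠ x i) := by
      intro z hz; ext i; simp only [mem_filter, mem_univ, true_and]
      have := hz i
      cases hy : z i <;> cases hx : x i <;> simp_all
    have e3 : ∀ z : Fin n → Bool, (∀ i, z i = true → x i = true) →
        univ.filter (fun i => x i = false ∧ z i = true) = ∅ := by
      intro z hz; ext i; simp only [mem_filter, mem_univ, true_and]
      have := hz i
      cases hy : z i <;> cases hx : x i <;> simp_all
    have e4 : ∀ z : Fin n → Bool, (∀ i, z i = true → x i = true) →
        univ.filter (fun i => x i = false ∧ z i = false) = univ.filter (fun i => x i = false) := by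
      intro z hz; ext i; simp only [mem_filter, mem_univ, true_and]
      have := hz i
      cases hy : z i <;> cases hx : x i <;> simp_all
    cases a <;> cases b
    · rw [e4 y h, e4 y' h']
    · rw [e3 y h, e3 y' h']
    · rw [e2 y h, e2 y' h']
      change hamm y x = hamm y' x
      omega
    · rw [e1 y h, e1 y' h']
      exact hw

lemma card_below {n : ℕ} (x : Fin n → Bool) (j : ℕ) :
    (univ.filter (fun y : Fin n → Bool => (∀ i, y i ≤ x i) ∧ wt y = j)).card
      = (wt x).choose j := by
  classical
  unfold wt
  rw [← card_powersetCard]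
  refine card_nbij' (fun y => univ.filter (fun i => y i = true)) (fun s i => decide (i ∈ s))
    ?_ ?_ ?_ ?_
  · intro y hy
    simp only [coe_filter, mem_univ, true_and, Set.mem_ofPred_eq, le_iff,
      mem_powersetCard, mem_coe] at hy ⊢
    refine ⟨fun i hi => ?_, hy.2⟩
    simp only [mem_filter, mem_univ, true_and] at hi ⊢
    exact hy.1 i hi
  · intro s hs
    simp only [coe_filter, mem_univ, true_and, Set.mem_ofPred_eq, le_iff,
      mem_powersetCard, mem_coe] at hs ⊢
    refine ⟨fun i hi => ?_, ?_⟩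
    · have := hs.1 (of_decide_eq_true hi)
      simpa using this
    · simpa using hs.2
  · intro y _
    funext i
    simp
  · intro s _
    ext i
    simp

lemma wt_pathPoint {n : ℕ} (π : Equiv.Perm (Fin n)) (j : ℕ) (hj : j ≤ n) :
    wt (pathPoint π j) = j := by
  unfold wt pathPoint
  have : (univ.filter (fun i : Fin n => decide ((π.symm i : ℕ) < j) = true)) =
      (univ.filter (fun i : Fin n => (i : ℕ) < j)).map π.toEmbedding := by
    ext i
    simp [Equiv.eq_symm_apply, mem_map_equiv]
  rw [this, card_map]
  simp [Fin.card_filter_val_lt, hj]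

lemma pathPoint_mono {n : ℕ} (π : Equiv.Perm (Fin n)) {j k : ℕ} (h : j ≤ k) :
    ∀ i, pathPoint π j i ≤ pathPoint π k i := by
  rw [le_iff]
  intro i
  simp only [pathPoint, decide_eq_true_eq]
  omega

/-- the path passes through `x` -/
def thru {n : ℕ} (x : Fin n → Bool) (π : Equiv.Perm (Fin n)) : Prop := pathPoint π (wt x) = x

instance {n : ℕ} (x : Fin n → Bool) (π : Equiv.Perm (Fin n)) : Decidable (thru x π) := by
  unfold thru; infer_instance

def cnt1 {n : ℕ} (x : Fin n → Bool) : ℕ := (univ.filter (fun π => thru x π)).card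

def cnt2 {n : ℕ} (x y : Fin n → Bool) : ℕ := (univ.filter (fun π => thru x π ∧ thru y π)).card

lemma cnt2_comm {n : ℕ} (x y : Fin n → Bool) : cnt2 x y = cnt2 y x := by
  unfold cnt2; congr 1; ext π; simp [and_comm]

lemma wt_comp {n : ℕ} (τ : Equiv.Perm (Fin n)) {y y' : Fin n → Bool}
    (h : ∀ i, y' (τ i) = y i) : wt y' = wt y := by
  unfold wt
  have : univ.filter (fun i => y' i = true) =
      (univ.filter (fun i => y i = true)).map τ.toEmbedding := by
    ext i
    simp only [mem_filter, mem_univ, true_and, mem_map_equiv]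
    rw [← h, Equiv.apply_symm_apply]
  rw [this, card_map]

lemma thru_mul {n : ℕ} (τ π : Equiv.Perm (Fin n)) {y y' : Fin n → Bool}
    (h : ∀ i, y' (τ i) = y i) : thru y' (τ * π) ↔ thru y π := by
  unfold thru
  rw [wt_comp τ h]
  have hp : ∀ i, pathPoint (τ * π) (wt y) (τ i) = pathPoint π (wt y) i := by
    intro i
    have : (τ * π).symm (τ i) = π.symm i := by
      rw [Equiv.symm_apply_eq]; simp
    simp only [pathPoint, this]
  constructor
  · intro hh
    funext i
    rw [← hp, hh, h]
  · intro hh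
    funext i
    obtain ⟨i, rfl⟩ := τ.surjective i
    rw [hp, hh, h]

lemma cnt2_eq {n : ℕ} {x y y' : Fin n → Bool} (h : ∀ i, y i ≤ x i) (h' : ∀ i, y' i ≤ x i)
    (hw : wt y = wt y') : cnt2 x y = cnt2 x y' := by
  obtain ⟨τ, h1, h2⟩ := exists_perm h h' hw
  unfold cnt2
  refine card_equiv (Equiv.mulLeft τ) ?_
  intro π
  simp only [mem_filter, mem_univ, true_and, Equiv.coe_mulLeft, thru_mul τ π h1, thru_mul τ π h2]

lemma cnt2_mul {n : ℕ} {x y : Fin n → Bool} (h : ∀ i, y i ≤ x i) :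
    cnt2 x y * (wt x).choose (wt y) = cnt1 x := by
  classical
  have hyx := wt_le_of_le h
  have hyn := wt_le y
  have h1 : cnt1 x = ∑ z ∈ univ.filter (fun z : Fin n → Bool => (∀ i, z i ≤ x i) ∧ wt z = wt y),
      cnt2 x z := by
    unfold cnt1
    rw [card_eq_sum_card_fiberwise (f := fun π => pathPoint π (wt y))
      (t := univ.filter (fun z : Fin n → Bool => (∀ i, z i ≤ x i) ∧ wt z = wt y))]
    · apply sum_congr rfl
      intro z hz
      simp only [mem_filter, mem_univ, true_and] at hz
      unfold cnt2
      congr 1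
      ext π
      simp only [mem_filter, mem_univ, true_and]
      unfold thru
      rw [hz.2]
    · intro π hπ
      simp only [coe_filter, mem_univ, true_and, Set.mem_ofPred_eq] at hπ ⊢
      refine ⟨?_, wt_pathPoint π _ hyn⟩
      have := pathPoint_mono π hyx
      unfold thru at hπ
      rwa [hπ] at this
  rw [h1, ← card_below, sum_congr rfl (g := fun _ => cnt2 x y)]
  · simp [mul_comm]
  · intro z hz
    simp only [mem_filter, mem_univ, true_and] at hz
    exact cnt2_eq hz.1 h hz.2

lemma wt_top {n : ℕ} : wt (fun _ : Fin n => true) = n := by simp [wt]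

lemma thru_top {n : ℕ} (π : Equiv.Perm (Fin n)) : thru (fun _ => true) π := by
  unfold thru
  rw [wt_top]
  funext i
  simp [pathPoint]

lemma cnt1_mul {n : ℕ} (y : Fin n → Bool) : cnt1 y * n.choose (wt y) = n.factorial := by
  have := cnt2_mul (x := fun _ => true) (y := y) (by simp [Bool.le_true])
  rw [wt_top] at this
  have h1 : cnt1 (fun _ : Fin n => true) = n.factorial := by
    unfold cnt1
    rw [filter_true_of_mem (fun π _ => thru_top π)]
    simp [Fintype.card_perm]
  have h2 : cnt2 (fun _ : Fin n => true) y = cnt1 y := by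
    unfold cnt1 cnt2
    congr 1
    ext π
    simp [thru_top]
  rw [h1, h2] at this
  exact this

lemma cnt2_zero {n : ℕ} {x y : Fin n → Bool} (h : ¬ (∀ i, y i ≤ x i)) (h' : ¬ (∀ i, x i ≤ y i)) :
    cnt2 x y = 0 := by
  unfold cnt2
  rw [card_eq_zero, filter_eq_empty_iff]
  rintro π - ⟨hx, hy⟩
  unfold thru at hx hy
  rcases le_total (wt x) (wt y) with hl | hl
  · apply h'
    have := pathPoint_mono π hl
    rwa [hx, hy] at this
  · apply h
    have := pathPoint_mono π hl
    rwa [hx, hy] at this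

open Classical in
lemma score_cnt {n : ℕ} (x : Fin n → Bool) (A : Finset (Fin n → Bool)) :
    (cnt1 x : ℝ) * scoreDown x A
      = ∑ y ∈ A.filter (fun y => ∀ i, y i ≤ x i), (cnt2 x y : ℝ) := by
  unfold scoreDown
  rw [mul_sum]
  rw [← sum_fiberwise_of_maps_to (t := range (n+1)) (g := fun y => hamm y x)]
  · apply sum_congr rfl
    intro k _
    rw [filter_filter]
    unfold densDown
    split_ifs with hk
    · rw [sum_congr rfl (g := fun _ => (cnt1 x : ℝ) / ((wt x).choose k : ℝ))]
      · rw [sum_const, nsmul_eq_mul]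
        ring
      · intro y hy
        simp only [mem_filter] at hy
        have h1 := cnt2_mul hy.2.1
        have h2 := hamm_add hy.2.1
        have h3 : (wt x).choose (wt y) = (wt x).choose k := by
          rw [← Nat.choose_symm hk]; congr 1; omega
        rw [h3] at h1
        have h4 : ((wt x).choose k : ℝ) ≠ 0 := by
          exact_mod_cast (Nat.choose_pos hk).ne'
        rw [eq_div_iff h4]
        exact_mod_cast h1
    · rw [filter_false_of_mem]
      · simp
      · rintro y _ ⟨h1, h2⟩
        have := hamm_add h1
        omega
  · intro y hy
    simp only [mem_filter] at hy
    have := hamm_add hy.2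
    have := wt_le x
    simp only [mem_range]
    omega

lemma second_moment {n : ℕ} (A : Finset (Fin n → Bool)) :
    (∑ x ∈ A, (cnt1 x : ℝ)) ^ 2 ≤ 2 * n.factorial * ∑ x ∈ A, (cnt1 x : ℝ) * scoreDown x A := by
  classical
  let N : Equiv.Perm (Fin n) → ℝ := fun π => ∑ x ∈ A, if thru x π then 1 else 0
  have h1 : ∑ π, N π = ∑ x ∈ A, (cnt1 x : ℝ) := by
    simp only [N]
    rw [sum_comm]
    apply sum_congr rfl
    intro x _
    simp [cnt1]
  have h2 : ∑ π, N π ^ 2 = ∑ x ∈ A, ∑ y ∈ A, (cnt2 x y : ℝ) := by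
    simp only [N, sq, sum_mul_sum]
    rw [sum_comm]
    apply sum_congr rfl
    intro x _
    rw [sum_comm]
    apply sum_congr rfl
    intro y _
    unfold cnt2
    rw [card_filter]
    push_cast
    apply sum_congr rfl
    intro π _
    by_cases hx : thru x π <;> by_cases hy : thru y π <;> simp [hx, hy]
  have h3 := sq_sum_le_card_mul_sum_sq (s := univ) (f := N)
  rw [h1, h2, card_univ, Fintype.card_perm, Fintype.card_fin] at h3
  have h4 : ∑ x ∈ A, ∑ y ∈ A, (cnt2 x y : ℝ) ≤ 2 * ∑ x ∈ A, (cnt1 x : ℝ) * scoreDown x A := by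
    simp only [score_cnt, sum_filter]
    have h5 : ∑ x ∈ A, ∑ y ∈ A, (cnt2 x y : ℝ) ≤
        ∑ x ∈ A, ∑ y ∈ A, ((if ∀ i, y i ≤ x i then (cnt2 x y : ℝ) else 0) +
          (if ∀ i, x i ≤ y i then (cnt2 y x : ℝ) else 0)) := by
      apply sum_le_sum; intro x _
      apply sum_le_sum; intro y _
      rw [cnt2_comm y x]
      split_ifs with ha hb hb
      · simp
      · simp
      · simp
      · simp [cnt2_zero ha hb]
    refine h5.trans (le_of_eq ?_)
    simp only [sum_add_distrib]
    rw [two_mul]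
    congr 1
    rw [sum_comm]
  calc _ ≤ _ := h3
    _ ≤ (n.factorial : ℝ) * (2 * ∑ x ∈ A, (cnt1 x : ℝ) * scoreDown x A) := by gcongr
    _ = _ := by ring

lemma cnt1_eq {n : ℕ} (x : Fin n → Bool) :
    (cnt1 x : ℝ) = n.factorial / (n.choose (wt x) : ℝ) := by
  have h4 : (n.choose (wt x) : ℝ) ≠ 0 := by
    exact_mod_cast (Nat.choose_pos (wt_le x)).ne'
  rw [eq_div_iff h4]
  exact_mod_cast cnt1_mul x

lemma densDown_nonneg {n : ℕ} (x : Fin n → Bool) (A : Finset (Fin n → Bool)) (k : ℕ) :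
    0 ≤ densDown x A k := by
  unfold densDown
  split_ifs <;> positivity

lemma scoreDown_nonneg {n : ℕ} (x : Fin n → Bool) (A : Finset (Fin n → Bool)) :
    0 ≤ scoreDown x A := sum_nonneg fun _ _ => densDown_nonneg _ _ _

/-- If all binomials on `A` are at least `q`, the total score is large. -/
lemma total_score {n : ℕ} (A : Finset (Fin n → Bool)) (q : ℝ) (hq : 0 < q)
    (hA : ∀ x ∈ A, q ≤ (n.choose (wt x) : ℝ)) :
    q * (A.card : ℝ) ^ 2 ≤ 2 * (n.choose (n / 2) : ℝ) ^ 2 * ∑ x ∈ A, scoreDown x A := by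
  have hM : (0 : ℝ) < n.choose (n / 2) := by
    exact_mod_cast Nat.choose_pos (Nat.div_le_self _ _)
  set M : ℝ := ((n.choose (n / 2) : ℕ) : ℝ) with hMdef
  have hf : (0 : ℝ) < n.factorial := by exact_mod_cast n.factorial_pos
  set F : ℝ := ((n.factorial : ℕ) : ℝ) with hF
  have h := second_moment A
  have l1 : A.card * (F / M) ≤ ∑ x ∈ A, (cnt1 x : ℝ) := by
    rw [← nsmul_eq_mul]
    apply card_nsmul_le_sum
    intro x _
    rw [cnt1_eq]
    have : (n.choose (wt x) : ℝ) ≤ M := by rw [hMdef]; exact_mod_cast Nat.choose_le_middle _ _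
    have : (0 : ℝ) < n.choose (wt x) := by exact_mod_cast Nat.choose_pos (wt_le x)
    gcongr
  have l2 : ∑ x ∈ A, (cnt1 x : ℝ) * scoreDown x A ≤ F / q * ∑ x ∈ A, scoreDown x A := by
    rw [mul_sum]
    apply sum_le_sum
    intro x hx
    apply mul_le_mul_of_nonneg_right _ (scoreDown_nonneg _ _)
    rw [cnt1_eq]
    have := hA x hx
    gcongr
  have l3 : (A.card * (F / M)) ^ 2 ≤ 2 * F * (F / q * ∑ x ∈ A, scoreDown x A) := by
    calc _ ≤ (∑ x ∈ A, (cnt1 x : ℝ)) ^ 2 := by gcongr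
      _ ≤ _ := h
      _ ≤ _ := by gcongr
  set S := ∑ x ∈ A, scoreDown x A
  have l4 : (A.card * (F / M)) ^ 2 = F ^ 2 / (M ^ 2 * q) * (q * (A.card : ℝ) ^ 2) := by
    field_simp
  have l5 : 2 * F * (F / q * S) = F ^ 2 / (M ^ 2 * q) * (2 * M ^ 2 * S) := by
    field_simp
  rw [l4, l5] at l3
  exact le_of_mul_le_mul_left l3 (by positivity)

lemma central_sq (k : ℕ) : (Nat.centralBinom k) ^ 2 * (2 * k + 1) ≤ 16 ^ k := by
  induction k with
  | zero => simp
  | succ k ih =>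
    have h := Nat.succ_mul_centralBinom_succ k
    have hpos : 0 < (k + 1) ^ 2 := by positivity
    apply Nat.le_of_mul_le_mul_left _ hpos
    calc (k + 1) ^ 2 * (Nat.centralBinom (k + 1) ^ 2 * (2 * (k + 1) + 1))
        = ((k + 1) * Nat.centralBinom (k + 1)) ^ 2 * (2 * k + 3) := by ring
      _ = (Nat.centralBinom k ^ 2 * (2 * k + 1)) * (4 * ((2 * k + 1) * (2 * k + 3))) := by
          rw [h]; ring
      _ ≤ 16 ^ k * (16 * (k + 1) ^ 2) := by
          apply Nat.mul_le_mul ih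
          nlinarith
      _ = (k + 1) ^ 2 * 16 ^ (k + 1) := by ring

lemma middle_sq (n : ℕ) : (n.choose (n / 2)) ^ 2 * n ≤ 4 ^ n := by
  rcases Nat.even_or_odd' n with ⟨k, rfl | rfl⟩
  · have h := central_sq k
    rw [Nat.mul_div_cancel_left _ (by norm_num), ← Nat.centralBinom_eq_two_mul_choose]
    rw [pow_mul]
    norm_num
    nlinarith [sq_nonneg (Nat.centralBinom k)]
  · have h := central_sq k
    have e : (2 * k + 1) / 2 = k := by omega
    rw [e]
    have h2 : (2 * k + 1).choose k ≤ 2 * Nat.centralBinom k := by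
      rcases k with _ | j
      · simp
      · rw [Nat.choose_succ_succ']
        have a := Nat.choose_le_centralBinom j (j + 1)
        have b := Nat.choose_le_centralBinom (j + 1) (j + 1)
        omega
    calc _ ≤ (2 * Nat.centralBinom k) ^ 2 * (2 * k + 1) := by gcongr
      _ = 4 * (Nat.centralBinom k ^ 2 * (2 * k + 1)) := by ring
      _ ≤ 4 * 16 ^ k := by gcongr
      _ = 4 ^ (2 * k + 1) := by rw [pow_succ, pow_mul]; norm_num; ring

lemma middle_sqrt (n : ℕ) : (n.choose (n / 2) : ℝ) * Real.sqrt n ≤ 2 ^ n := by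
  have h : ((n.choose (n / 2) : ℝ)) ^ 2 * n ≤ 4 ^ n := by exact_mod_cast middle_sq n
  apply le_of_sq_le_sq _ (by positivity)
  rw [mul_pow, Real.sq_sqrt (by positivity), ← pow_mul, mul_comm n 2, pow_mul]
  norm_num
  exact h

/-- Binomial lower bound, lower half, descending from the middle. -/
lemma choose_lower_aux (n : ℕ) (hn : 0 < n) (i : ℕ) : ∀ k, k + i = n / 2 → n ≤ 4 * k →
    (n.choose (n / 2) : ℝ) * Real.exp (-((n : ℝ) - 2 * k) ^ 2 / n) ≤ n.choose k := by
  have hn' : (0 : ℝ) < n := by exact_mod_cast hn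
  induction i with
  | zero =>
    intro k hk _
    have : k = n / 2 := by omega
    rw [this]
    apply mul_le_of_le_one_right (by positivity)
    rw [Real.exp_le_one_iff]
    apply div_nonpos_of_nonpos_of_nonneg _ hn'.le
    have := sq_nonneg ((n : ℝ) - 2 * ((n / 2 : ℕ) : ℝ))
    linarith
  | succ i ih =>
    intro k hk h4
    have hi := ih (k + 1) (by omega) (by omega)
    have hrec : n.choose (k + 1) * (k + 1) = n.choose k * (n - k) := Nat.choose_succ_right_eq n k
    have hkn : 2 * (k + 1) ≤ n := by omega
    have hrec' : (n.choose (k + 1) : ℝ) * (k + 1) = n.choose k * ((n : ℝ) - k) := by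
      rw [← Nat.cast_sub (by omega)]
      exact_mod_cast hrec
    have hkn' : 2 * ((k : ℝ) + 1) ≤ n := by exact_mod_cast hkn
    have h4' : (n : ℝ) ≤ 4 * k := by exact_mod_cast h4
    have hk1 : (0 : ℝ) < (k : ℝ) + 1 := by positivity
    have hnk : (0 : ℝ) < (n : ℝ) - k := by linarith
    -- ratio bound
    have hr : Real.exp (-(4 * ((n : ℝ) - 2 * k - 1) / n)) ≤ ((k : ℝ) + 1) / ((n : ℝ) - k) := by
      have a := Real.add_one_le_exp (4 * ((n : ℝ) - 2 * k - 1) / n)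
      have b : ((n : ℝ) - k) / (k + 1) ≤ 4 * ((n : ℝ) - 2 * k - 1) / n + 1 := by
        have : ((n : ℝ) - k) / (k + 1) = ((n : ℝ) - 2 * k - 1) / (k + 1) + 1 := by
          field_simp; ring
        rw [this]
        gcongr ?_ + 1
        rw [div_le_div_iff₀ hk1 hn']
        have : 0 ≤ (n : ℝ) - 2 * k - 1 := by linarith
        nlinarith
      rw [Real.exp_neg, inv_le_comm₀ (Real.exp_pos _) (by positivity), inv_div]
      linarith
    have hsplit : Real.exp (-((n : ℝ) - 2 * k) ^ 2 / n) =
        Real.exp (-((n : ℝ) - 2 * ((k + 1 : ℕ) : ℝ)) ^ 2 / n) *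
          Real.exp (-(4 * ((n : ℝ) - 2 * k - 1) / n)) := by
      rw [← Real.exp_add]
      congr 1
      push_cast
      field_simp
      ring
    rw [hsplit, ← mul_assoc]
    calc _ ≤ (n.choose (k + 1) : ℝ) * (((k : ℝ) + 1) / ((n : ℝ) - k)) := by gcongr
      _ = n.choose k := by
        rw [← mul_div_assoc, hrec', mul_div_assoc, div_self hnk.ne', mul_one]

lemma choose_lower (n : ℕ) (hn : 0 < n) (k : ℕ) (D : ℝ) (hD : D ≤ n / 2)
    (h1 : ((n : ℝ) - D) / 2 ≤ k) (h2 : (k : ℝ) ≤ ((n : ℝ) + D) / 2) :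
    (n.choose (n / 2) : ℝ) * Real.exp (-D ^ 2 / n) ≤ n.choose k := by
  have hn' : (0 : ℝ) < n := by exact_mod_cast hn
  wlog hk : k ≤ n / 2 generalizing k with H
  · have hkn : k ≤ n := by
      have : (k : ℝ) ≤ n := by linarith
      exact_mod_cast this
    have := H (n - k) (by rw [Nat.cast_sub hkn]; linarith) (by rw [Nat.cast_sub hkn]; linarith)
      (by omega)
    rwa [Nat.choose_symm hkn] at this
  · have h := choose_lower_aux n hn (n / 2 - k) k (by omega) (by
      have : (n : ℝ) ≤ 4 * k := by linarith
      exact_mod_cast this)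
    refine le_trans ?_ h
    have : 2 * (k : ℝ) ≤ n := by
      have : 2 * k ≤ n := by omega
      exact_mod_cast this
    have h5 : ((n : ℝ) - 2 * k) ^ 2 ≤ D ^ 2 := by
      apply pow_le_pow_left₀ <;> linarith
    gcongr

lemma dPar_bound (n : ℕ) (ε : ℝ) :
    (dPar n ε : ℝ) ≤ 2 * (Real.sqrt (2 * n * Real.log (100 / ε)) + 1) := by
  unfold dPar
  push_cast
  have := (Nat.ceil_lt_add_one (Real.sqrt_nonneg (2 * n * Real.log (100 / ε)))).le
  linarith

lemma exp_bound (n : ℕ) (hn : 2 ≤ n) (ε : ℝ) (h1 : 1 / (n : ℝ) ≤ ε) (h2 : ε ≤ 1 / 2) :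
    Real.exp (-200) * (ε / 100) ^ 8 ≤ Real.exp (-(dPar n ε : ℝ) ^ 2 / n) := by
  have hn' : (2 : ℝ) ≤ n := by exact_mod_cast hn
  have hε : 0 < ε := lt_of_lt_of_le (by positivity) h1
  set L := Real.log (100 / ε) with hL
  have hL0 : 0 ≤ L := Real.log_nonneg (by rw [le_div_iff₀ hε]; linarith)
  have e : (ε / 100) ^ 8 = Real.exp (-(8 * L)) := by
    rw [hL, ← inv_div ε 100, Real.log_inv]
    have : -(8 * -Real.log (ε / 100)) = ((8 : ℕ) : ℝ) * Real.log (ε / 100) := by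
      push_cast; ring
    rw [this, Real.exp_nat_mul, Real.exp_log (by positivity)]
  rw [e, ← Real.exp_add, Real.exp_le_exp]
  have hLn : L ≤ 100 * n := by
    have a := Real.log_le_sub_one_of_pos (show 0 < 100 / ε by positivity)
    have : 100 / ε ≤ 100 * n := by
      rw [div_le_iff₀ hε]
      rw [div_le_iff₀ (by linarith)] at h1
      nlinarith
    linarith
  have hd := dPar_bound n ε
  rw [← hL] at hd
  set s := Real.sqrt (2 * n * L) with hs
  have hs0 : 0 ≤ s := Real.sqrt_nonneg _
  have hs2 : s ^ 2 = 2 * n * L := Real.sq_sqrt (by positivity)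
  have hsn : s ≤ 15 * n := by
    apply le_of_sq_le_sq _ (by positivity)
    rw [hs2]; nlinarith
  have hd2 : (dPar n ε : ℝ) ^ 2 ≤ 4 * (s + 1) ^ 2 := by
    calc _ ≤ (2 * (s + 1)) ^ 2 := by gcongr
      _ = _ := by ring
  rw [neg_div, ← sub_nonneg]
  have : (dPar n ε : ℝ) ^ 2 / n ≤ 200 + 8 * L := by
    rw [div_le_iff₀ (by linarith)]
    nlinarith
  linarith

/-- in the degenerate regime `ε √n` is bounded -/
lemma degenerate (n : ℕ) (hn : 2 ≤ n) (ε : ℝ) (h1 : 1 / (n : ℝ) ≤ ε) (h2 : ε ≤ 1 / 2)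
    (hd : (n : ℝ) / 2 < dPar n ε) : ε * Real.sqrt n ≤ 12800 := by
  have hn' : (2 : ℝ) ≤ n := by exact_mod_cast hn
  have hε : 0 < ε := lt_of_lt_of_le (by positivity) h1
  have hsn : Real.sqrt n ≤ n := by
    rw [Real.sqrt_le_left (by positivity)]; nlinarith
  rcases le_or_gt n 8 with h8 | h8
  · have : (n : ℝ) ≤ 8 := by exact_mod_cast h8
    nlinarith [Real.sqrt_nonneg (n : ℝ)]
  have h8' : (8 : ℝ) ≤ n := by exact_mod_cast h8.le
  have hb := dPar_bound n ε
  set L := Real.log (100 / ε) with hL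
  have hL0 : 0 ≤ L := Real.log_nonneg (by rw [le_div_iff₀ hε]; linarith)
  set s := Real.sqrt (2 * n * L) with hs
  have hs2 : s ^ 2 = 2 * n * L := Real.sq_sqrt (by positivity)
  have h3 : (n : ℝ) / 8 < s := by linarith
  have h4 : ((n : ℝ) / 8) ^ 2 < 2 * n * L := by
    rw [← hs2]; gcongr
  have h5 : (n : ℝ) / 128 < L := by nlinarith
  have h6 : L + 1 ≤ 100 / ε := by
    have := Real.add_one_le_exp L
    rwa [hL, Real.exp_log (by positivity), ← hL] at this
  rw [le_div_iff₀ hε] at h6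
  nlinarith

lemma bucket_cover (n k : ℕ) (hk : k ∈ range (n + 1)) :
    ∃ l ∈ range (mPar n + 1), k ∈ bucket l := by
  simp only [mem_range] at hk
  rcases Nat.eq_zero_or_pos k with rfl | h
  · exact ⟨0, by simp, by simp [bucket]⟩
  · refine ⟨Nat.log 2 k + 1, ?_, ?_⟩
    · simp only [mem_range, mPar]
      have h1 : 2 ^ Nat.log 2 k ≤ k := Nat.pow_log_le_self 2 h.ne'
      have h2 : n + 1 ≤ 2 ^ Nat.clog 2 (n + 1) := Nat.le_pow_clog (by norm_num) _
      have : 2 ^ Nat.log 2 k < 2 ^ Nat.clog 2 (n + 1) := by omega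
      have := (Nat.pow_lt_pow_iff_right (by norm_num : 1 < 2)).mp this
      omega
    · simp only [bucket, Nat.succ_ne_zero, if_false, mem_Ico, Nat.add_sub_cancel]
      exact ⟨Nat.pow_log_le_self 2 h.ne', Nat.lt_pow_succ_log_self (by norm_num) k⟩

lemma score_le_buckets {n : ℕ} (x : Fin n → Bool) (A : Finset (Fin n → Bool)) :
    scoreDown x A ≤ ∑ l ∈ range (mPar n + 1), ∑ k ∈ bucket l, densDown x A k := by
  classical
  unfold scoreDown
  calc _ ≤ ∑ k ∈ (range (mPar n + 1)).biUnion bucket, densDown x A k := by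
        apply sum_le_sum_of_subset_of_nonneg
        · intro k hk
          rw [mem_biUnion]
          exact bucket_cover n k hk
        · intros; exact densDown_nonneg _ _ _
    _ ≤ _ := by
        rw [sum_biUnion]
        intro a _ b _ hab
        simp only [Function.onFun]
        rw [Finset.disjoint_left]
        intro k ha hb
        apply hab
        have key : ∀ a, k ∈ bucket a → a = if k = 0 then 0 else Nat.log 2 k + 1 := by
          intro a ha
          unfold bucket at ha
          split_ifs at ha with h0
          · simp at ha; simp [ha, h0]
          · rw [mem_Ico] at ha
            have : 0 < 2 ^ (a - 1) := by positivity
            have hk0 : k ≠ 0 := by omega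
            rw [if_neg hk0]
            have : Nat.log 2 k = a - 1 := by
              rw [Nat.log_eq_iff (by right; exact ⟨by norm_num, hk0⟩)]
              refine ⟨ha.1, ?_⟩
              rw [Nat.sub_add_cancel (by omega)]
              exact ha.2
            omega
        rw [key a ha, key b hb]

lemma mPar_bound (n : ℕ) (hn : 2 ≤ n) : ((mPar n : ℝ) + 1) ≤ 3 * Real.logb 2 n ∧ 
    1 ≤ Real.logb 2 n := by
  have hn' : (2 : ℝ) ≤ n := by exact_mod_cast hn
  have h1 : 1 ≤ Real.logb 2 n := by
    rw [Real.le_logb_iff_rpow_le (by norm_num) (by linarith)]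
    simpa using hn'
  refine ⟨?_, h1⟩
  have h2 : mPar n ≤ Nat.log 2 n + 1 := by
    unfold mPar
    apply (Nat.clog_le_iff_le_pow (by norm_num)).mpr
    exact Nat.lt_pow_succ_log_self (by norm_num) n
  have h3 : (Nat.log 2 n : ℝ) ≤ Real.logb 2 n := by
    have := Real.natLog_le_logb n 2
    exact_mod_cast this
  have : (mPar n : ℝ) ≤ Nat.log 2 n + 1 := by exact_mod_cast h2
  linarith

lemma dens_zero {n : ℕ} (x : Fin n → Bool) (A : Finset (Fin n → Bool)) (hx : x ∈ A) :
    1 ≤ densDown x A 0 := by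
  classical
  unfold densDown
  simp only [Nat.zero_le, if_true, Nat.choose_zero_right, Nat.cast_one, div_one]
  rw [Nat.one_le_cast, Nat.one_le_iff_ne_zero, ← Nat.pos_iff_ne_zero, card_pos]
  exact ⟨x, by simp [hx, hamm]⟩

lemma sqrt_log (ε : ℝ) (h0 : 0 < ε) (h2 : ε ≤ 1 / 2) : 1 / 2 ≤ Real.sqrt (Real.log (1 / ε)) := by
  apply Real.le_sqrt_of_sq_le
  have : Real.log 2 ≤ Real.log (1 / ε) := by
    apply Real.log_le_log (by norm_num)
    rw [le_div_iff₀ h0]; linarith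
  have := Real.log_two_gt_d9
  norm_num
  norm_num at *
  linarith

end GB

theorem good_bucket_exists :
    ∃ c : ℝ, 0 < c ∧ ∀ n : ℕ, 2 ≤ n → ∀ ε : ℝ, 1 / (n : ℝ) ≤ ε → ε ≤ 1 / 2 →
      ∀ A : Finset (Fin n → Bool), A ⊆ Lmid n ε → ∀ σ : ℝ,
        (A.card : ℝ) = σ * 2 ^ n →
        ∃ ℓ : ℕ, ℓ ≤ mPar n ∧
          c * ε ^ 8 * σ ^ 2 * Real.sqrt n * 2 ^ n /
              (Real.logb 2 n * Real.sqrt (Real.log (1 / ε))) ≤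
            ∑ x ∈ A, ∑ k ∈ bucket ℓ, densDown x A k := by
  set κ : ℝ := Real.exp (-200) * (1 / 100) ^ 8 with hκ
  have hκ0 : 0 < κ := by positivity
  have hκ1 : κ ≤ 1 / 100 ^ 8 := by
    have : Real.exp (-200) ≤ 1 := by rw [Real.exp_le_one_iff]; norm_num
    rw [hκ]; norm_num at *; try linarith
  refine ⟨κ / 12, by positivity, ?_⟩
  intro n hn ε h1 h2 A hA σ hσ
  have hn' : (2 : ℝ) ≤ n := by exact_mod_cast hn
  have hε : 0 < ε := lt_of_lt_of_le (by positivity) h1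
  obtain ⟨hm, hlog⟩ := GB.mPar_bound n hn
  have hsl := GB.sqrt_log ε hε h2
  set lg := Real.logb 2 n
  set sl := Real.sqrt (Real.log (1 / ε))
  set rn := Real.sqrt n with hrn
  have hrn0 : 0 < rn := Real.sqrt_pos.mpr (by linarith)
  have hP : (0 : ℝ) < 2 ^ n := by positivity
  have hσ0 : 0 ≤ σ := by
    by_contra hneg
    push Not at hneg
    have : σ * 2 ^ n < 0 := mul_neg_of_neg_of_pos hneg hP
    have : (0 : ℝ) ≤ A.card := by positivity
    linarith
  have hσ1 : σ ≤ 1 := by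
    have : (A.card : ℝ) ≤ 2 ^ n := by
      have := card_le_univ A
      simp at this
      exact_mod_cast this
    rw [hσ] at this
    by_contra hneg
    push Not at hneg
    nlinarith
  have hT : ∀ T : ℝ, 0 ≤ T → T / (lg * sl) * lg ≤ 2 * T := by
    intro T hT
    rw [div_mul_eq_mul_div, div_le_iff₀ (by positivity)]
    nlinarith [mul_nonneg hT (by linarith : (0:ℝ) ≤ lg)]
  set T : ℝ := κ / 12 * ε ^ 8 * σ ^ 2 * rn * 2 ^ n with hTdef
  have hT0 : 0 ≤ T := by positivity
  have hTT := hT T hT0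
  have hQ0 : 0 ≤ T / (lg * sl) := by positivity
  rcases lt_or_ge ((n : ℝ) / 2) (dPar n ε) with hd | hd
  · -- degenerate case
    refine ⟨0, Nat.zero_le _, ?_⟩
    have hdeg := GB.degenerate n hn ε h1 h2 hd
    have hl : (A.card : ℝ) ≤ ∑ x ∈ A, ∑ k ∈ bucket 0, densDown x A k := by
      have : ∑ x ∈ A, (1 : ℝ) ≤ ∑ x ∈ A, ∑ k ∈ bucket 0, densDown x A k := by
        apply sum_le_sum
        intro x hx
        simp only [bucket, if_true, sum_singleton]
        exact GB.dens_zero x A hx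
      simpa using this
    refine le_trans ?_ hl
    rw [hσ]
    have e1 : T / (lg * sl) ≤ 2 * T := by nlinarith
    refine e1.trans ?_
    have e2 : ε ^ 8 * rn ≤ 12800 := by
      have : ε ^ 8 ≤ ε := by
        have := pow_le_pow_of_le_one hε.le (by linarith) (show 1 ≤ 8 by norm_num)
        simpa using this
      calc _ ≤ ε * rn := by gcongr
        _ ≤ _ := hdeg
    have e3 : 2 * (κ / 12 * (ε ^ 8 * rn)) ≤ 1 := by
      have : κ / 12 * (ε ^ 8 * rn) ≤ (1 / 100 ^ 8) / 12 * 12800 := by gcongr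
      norm_num at this ⊢
      linarith
    have e4 : σ ^ 2 ≤ σ := by nlinarith
    calc 2 * T = (2 * (κ / 12 * (ε ^ 8 * rn))) * (σ ^ 2 * 2 ^ n) := by rw [hTdef]; ring
      _ ≤ 1 * (σ * 2 ^ n) := by gcongr
      _ = _ := by ring
  · by_contra hcon
    push Not at hcon
    set M : ℝ := ((n.choose (n / 2) : ℕ) : ℝ) with hM
    have hM0 : 0 < M := by
      rw [hM]; exact_mod_cast Nat.choose_pos (Nat.div_le_self _ _)
    have hq : ∀ x ∈ A, M * (κ * ε ^ 8) ≤ (n.choose (wt x) : ℝ) := by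
      intro x hx
      have hx' := hA hx
      simp only [Lmid, mem_filter, mem_univ, true_and] at hx'
      have a := GB.choose_lower n (by omega) (wt x) (dPar n ε) hd hx'.1 hx'.2
      have b := GB.exp_bound n hn ε h1 h2
      refine le_trans ?_ a
      apply mul_le_mul_of_nonneg_left _ hM0.le
      refine le_trans (le_of_eq ?_) b
      rw [hκ]; ring
    have hts := GB.total_score A (M * (κ * ε ^ 8)) (by positivity) hq
    rw [← hM] at hts
    set S := ∑ x ∈ A, scoreDown x A with hS
    have hMr := GB.middle_sqrt n
    rw [← hM, ← hrn] at hMr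
    -- S upper bound
    have hSu : S < (mPar n + 1) * (T / (lg * sl)) := by
      calc S ≤ ∑ x ∈ A, ∑ l ∈ range (mPar n + 1), ∑ k ∈ bucket l, densDown x A k :=
            sum_le_sum fun x _ => GB.score_le_buckets x A
        _ = ∑ l ∈ range (mPar n + 1), ∑ x ∈ A, ∑ k ∈ bucket l, densDown x A k := sum_comm
        _ < ∑ l ∈ range (mPar n + 1), T / (lg * sl) := by
            apply sum_lt_sum_of_nonempty
            · simp
            · intro l hl
              exact hcon l (by simp at hl; omega)
        _ = _ := by simp
    have hSu2 : S < 6 * T := by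
      have : (mPar n + 1) * (T / (lg * sl)) ≤ 3 * lg * (T / (lg * sl)) := by gcongr
      nlinarith
    have hSl : κ * ε ^ 8 * (σ * 2 ^ n) ^ 2 ≤ 2 * M * S := by
      rw [hσ] at hts
      apply le_of_mul_le_mul_left _ hM0
      linarith
    have hfin : 2 * M * (6 * T) ≤ κ * ε ^ 8 * (σ * 2 ^ n) ^ 2 := by
      calc 2 * M * (6 * T) = κ * ε ^ 8 * σ ^ 2 * 2 ^ n * (M * rn) := by rw [hTdef]; ring
        _ ≤ κ * ε ^ 8 * σ ^ 2 * 2 ^ n * 2 ^ n := by gcongr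
        _ = _ := by ring
    have : 2 * M * S < 2 * M * (6 * T) := by gcongr
    linarith
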